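/- Let n ≥ 0 be an integer. Then for every real number x, Σ_{k=1}^{n} (B_k(x)/k) E_{n-k}(x) − Σ_{l=2}^{n} C(n, l) 2^l (B_l/l) E_{n-l}(x) = H_n E_n(x). -/

import Mathlib

open Finset

/-- The `n`-th Bernoulli polynomial evaluated at a real `x`:
`B_n(x) = ∑_{k=0}^n (n choose k) B_k x^(n-k)`, where `B_k` is the `k`-th Bernoulli number
(with the convention `B_1 = -1/2`, i.e. generating function `z e^{xz}/(e^z - 1)`). -/
noncomputable def bernoulliPoly (n : ℕ) (x : ℝ) : ℝ :=
  ∑ k ∈ Finset.range (n + 1), ((bernoulli k : ℚ) : ℝ) * (n.choose k : ℝ) * x ^ (n - k)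

/-- The `n`-th harmonic number `H_n = ∑_{k=1}^n 1/k` as a real number. -/
noncomputable def harm (n : ℕ) : ℝ :=
  ∑ k ∈ Finset.range n, (1 : ℝ) / (k + 1)

/-- The `n`-th Euler polynomial evaluated at a real `x`, defined via the classical identity
`E_n(x) = (2/(n+1)) * (B_{n+1}(x) - 2^{n+1} B_{n+1}(x/2))`, which is equivalent to the
generating-function definition `2 e^{xz}/(e^z + 1) = ∑ E_n(x) z^n/n!`. -/
noncomputable def eulerPoly (n : ℕ) (x : ℝ) : ℝ :=
  2 / (n + 1) * (bernoulliPoly (n + 1) x - 2 ^ (n + 1) * bernoulliPoly (n + 1) (x / 2))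

lemma bp_eq (n : ℕ) (x : ℝ) : bernoulliPoly n x = Polynomial.aeval x (Polynomial.bernoulli n) := by
  rw [Polynomial.bernoulli_def, ← Finset.sum_range_reflect]
  simp only [map_sum, Polynomial.aeval_monomial, bernoulliPoly]
  refine Finset.sum_congr rfl fun k hk => ?_
  have hk' : k ≤ n := by simpa [Nat.lt_succ_iff] using hk
  have h1 : n + 1 - 1 - k = n - k := by omega
  rw [h1]
  simp [Nat.choose_symm hk', Nat.sub_sub_self hk']

lemma bp_deriv (n : ℕ) (x : ℝ) :
    HasDerivAt (bernoulliPoly (n + 1)) ((n + 1) * bernoulliPoly n x) x := by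
  have h : bernoulliPoly (n + 1) = fun x => Polynomial.aeval x (Polynomial.bernoulli (n + 1)) :=
    funext fun x => bp_eq _ x
  rw [h]
  have := (Polynomial.bernoulli (n + 1)).hasDerivAt_aeval x
  rw [Polynomial.derivative_bernoulli_add_one] at this
  simpa [bp_eq] using this

lemma bp_zero (n : ℕ) : bernoulliPoly n 0 = (bernoulli n : ℝ) := by
  rw [bp_eq, ← Polynomial.bernoulli_eval_zero]
  simpa using (Polynomial.aeval_algebraMap_apply ℝ (0 : ℚ) (Polynomial.bernoulli n))

lemma bp_one (n : ℕ) (hn : n ≠ 1) : bernoulliPoly n 1 = (bernoulli n : ℝ) := by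
  rw [bp_eq, bernoulli_eq_bernoulli'_of_ne_one hn, ← Polynomial.bernoulli_eval_one]
  simpa using (Polynomial.aeval_algebraMap_apply ℝ (1 : ℚ) (Polynomial.bernoulli n))

lemma bp0 (x : ℝ) : bernoulliPoly 0 x = 1 := by simp [bernoulliPoly]

lemma bp1 (x : ℝ) : bernoulliPoly 1 x = x - 1 / 2 := by
  simp [bernoulliPoly, Finset.sum_range_succ]; ring

/-- constant functions from zero derivative -/
lemma const_of {f : ℝ → ℝ} (h : ∀ x, HasDerivAt f 0 x) (x y : ℝ) : f x = f y :=
  is_const_of_deriv_eq_zero (fun x => (h x).differentiableAt) (fun x => (h x).deriv) x y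

noncomputable def DD (n : ℕ) (x : ℝ) : ℝ :=
  2 ^ n * (bernoulliPoly n (x / 2) + bernoulliPoly n ((x + 1) / 2)) - 2 * bernoulliPoly n x

lemma DD_deriv (n : ℕ) (x : ℝ) : HasDerivAt (DD (n + 1)) ((n + 1) * DD n x) x := by
  have h1 : HasDerivAt (fun x : ℝ => x / 2) (1 / 2) x := (hasDerivAt_id x).div_const 2
  have h2 : HasDerivAt (fun x : ℝ => (x + 1) / 2) (1 / 2) x :=
    ((hasDerivAt_id x).add_const 1).div_const 2
  have h3 := (bp_deriv n (x / 2)).comp x h1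
  have h4 := (bp_deriv n ((x + 1) / 2)).comp x h2
  have h5 := ((h3.add h4).const_mul (2 ^ (n + 1))).sub ((bp_deriv n x).const_mul 2)
  refine h5.congr_deriv ?_
  simp only [DD]
  ring

lemma DD_zero (n : ℕ) (x : ℝ) : DD n x = 0 := by
  induction n generalizing x with
  | zero => simp [DD, bp0]; norm_num
  | succ n ih =>
    have hc : ∀ x, DD (n + 1) x = DD (n + 1) 0 := fun x =>
      const_of (fun x => by simpa [ih] using DD_deriv n x) x 0
    have hd : ∀ x, HasDerivAt (fun x => DD (n + 2) x - (n + 2) * DD (n + 1) 0 * x) 0 x := by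
      intro x
      have h := (DD_deriv (n + 1) x).sub ((hasDerivAt_id x).const_mul ((n + 2) * DD (n + 1) 0))
      refine h.congr_deriv ?_
      rw [hc x]; push_cast; ring
    have h01 := const_of hd 1 0
    have e : DD (n + 2) 1 = DD (n + 2) 0 := by
      have : ((1 : ℝ) + 1) / 2 = 1 := by norm_num
      simp only [DD, this, zero_div, zero_add, bp_zero, bp_one (n + 2) (by omega)]
      ring
    rw [hc x]
    simp only [e, mul_one, mul_zero, sub_zero] at h01
    have h6 : ((n : ℝ) + 2) * DD (n + 1) 0 = 0 := by linarith
    have h7 : (n : ℝ) + 2 ≠ 0 := by positivity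
    exact (mul_eq_zero.mp h6).resolve_left h7

lemma ep0 (x : ℝ) : eulerPoly 0 x = 1 := by
  simp [eulerPoly, bp1]; ring

lemma ep_deriv (n : ℕ) (x : ℝ) :
    HasDerivAt (eulerPoly (n + 1)) ((n + 1) * eulerPoly n x) x := by
  have h1 : HasDerivAt (fun x : ℝ => x / 2) (1 / 2) x := (hasDerivAt_id x).div_const 2
  have h3 := (bp_deriv (n + 1) (x / 2)).comp x h1
  have h5 := ((bp_deriv (n + 1) x).sub (h3.const_mul (2 ^ (n + 1 + 1)))).const_mul
    (2 / (((n + 1 : ℕ) : ℝ) + 1))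
  refine h5.congr_deriv ?_
  simp only [eulerPoly]
  push_cast
  have : (n : ℝ) + 1 + 1 ≠ 0 := by positivity
  have : (n : ℝ) + 1 ≠ 0 := by positivity
  field_simp
  ring

lemma ep_deriv' (n : ℕ) (x : ℝ) :
    HasDerivAt (eulerPoly n) (n * eulerPoly (n - 1) x) x := by
  cases n with
  | zero =>
    have : eulerPoly 0 = fun _ => 1 := funext ep0
    rw [this]; simpa using hasDerivAt_const x (1 : ℝ)
  | succ n => simpa using ep_deriv n x

lemma ep_zero (n : ℕ) :
    eulerPoly n 0 = 2 / (n + 1) * ((1 - 2 ^ (n + 1)) * (bernoulli (n + 1) : ℝ)) := by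
  simp only [eulerPoly, zero_div, bp_zero]; ring

lemma ep_one (n : ℕ) : eulerPoly (n + 1) 1 = - eulerPoly (n + 1) 0 := by
  have h := DD_zero (n + 2) 0
  simp only [DD, zero_div, zero_add, bp_zero] at h
  rw [ep_zero]
  simp only [eulerPoly, bp_one (n + 1 + 1) (by omega)]
  have h' : (2 : ℝ) ^ (n + 1 + 1) * bernoulliPoly (n + 1 + 1) (1 / 2)
    = 2 * (bernoulli (n + 1 + 1) : ℝ) - 2 ^ (n + 1 + 1) * (bernoulli (n + 1 + 1) : ℝ) := by
    linear_combination h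
  rw [h']; ring

noncomputable def SS (n : ℕ) (x : ℝ) : ℝ :=
  ∑ k ∈ Finset.Icc 1 n, bernoulliPoly k x / (k : ℝ) * eulerPoly (n - k) x

noncomputable def TT (n : ℕ) (x : ℝ) : ℝ :=
  ∑ l ∈ Finset.Icc 2 n, (n.choose l : ℝ) * (2 : ℝ) ^ l *
        (((bernoulli l : ℚ) : ℝ) / (l : ℝ)) * eulerPoly (n - l) x

lemma SS_deriv (n : ℕ) (x : ℝ) :
    HasDerivAt (SS (n + 1)) (eulerPoly n x + (n + 1) * SS n x) x := by
  have h : HasDerivAt (SS (n + 1)) (∑ k ∈ Finset.Icc 1 (n + 1),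
      (bernoulliPoly (k - 1) x * eulerPoly (n + 1 - k) x +
        bernoulliPoly k x / (k : ℝ) * (((n + 1 - k : ℕ) : ℝ) * eulerPoly (n + 1 - k - 1) x))) x := by
    unfold SS
    refine HasDerivAt.fun_sum fun k hk => ?_
    obtain ⟨j, rfl⟩ : ∃ j, k = j + 1 := ⟨k - 1, by simp at hk; omega⟩
    refine (((bp_deriv j x).div_const _).mul (ep_deriv' (n + 1 - (j + 1)) x)).congr_deriv ?_
    have : (j : ℝ) + 1 ≠ 0 := by positivity
    push_cast
    field_simp
  refine h.congr_deriv ?_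
  rw [Finset.sum_add_distrib, Finset.sum_Icc_succ_top (by omega) (fun k =>
    bernoulliPoly k x / (k : ℝ) * (((n + 1 - k : ℕ) : ℝ) * eulerPoly (n + 1 - k - 1) x))]
  have e1 : ∑ k ∈ Finset.Icc 1 (n + 1), bernoulliPoly (k - 1) x * eulerPoly (n + 1 - k) x
      = eulerPoly n x + ∑ k ∈ Finset.Icc 1 n, bernoulliPoly k x * eulerPoly (n - k) x := by
    rw [← Finset.Ico_add_one_right_eq_Icc, ← Finset.Ico_add_one_right_eq_Icc,
      Finset.sum_Ico_eq_sum_range, Finset.sum_Ico_eq_sum_range]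
    have : n + 1 + 1 - 1 = n + 1 := by omega
    rw [this, Finset.sum_range_succ', add_comm]
    congr 1
    · simp [bp0]
    · refine Finset.sum_congr rfl fun k _ => ?_
      congr 2 <;> omega
  rw [e1]
  unfold SS
  rw [Finset.mul_sum, add_assoc]
  congr 1
  simp only [Nat.sub_self, Nat.cast_zero, zero_mul, mul_zero, add_zero]
  rw [← Finset.sum_add_distrib]
  refine Finset.sum_congr rfl fun k hk => ?_
  simp only [Finset.mem_Icc] at hk
  have a : n + 1 - k - 1 = n - k := by omega
  have b : (k : ℝ) ≠ 0 := by have : k ≠ 0 := by omega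
                             exact_mod_cast this
  rw [a, Nat.cast_sub (by omega)]
  push_cast
  field_simp
  ring

lemma TT_deriv (n : ℕ) (x : ℝ) :
    HasDerivAt (TT (n + 1)) ((n + 1) * TT n x) x := by
  have h : HasDerivAt (TT (n + 1)) (∑ l ∈ Finset.Icc 2 (n + 1),
      ((n + 1).choose l : ℝ) * (2 : ℝ) ^ l * (((bernoulli l : ℚ) : ℝ) / (l : ℝ)) *
        (((n + 1 - l : ℕ) : ℝ) * eulerPoly (n + 1 - l - 1) x)) x := by
    unfold TT
    exact HasDerivAt.fun_sum fun k hk => (ep_deriv' (n + 1 - k) x).const_mul _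
  refine h.congr_deriv ?_
  have key : ∀ l, (((n + 1).choose l : ℝ)) * ((n + 1 - l : ℕ) : ℝ) = (n + 1) * (n.choose l : ℝ) := by
    intro l
    have := Nat.add_one_mul_choose_eq n l
    have h2 := Nat.choose_mul_succ_eq n l
    have h3 : ((n.choose l * (n + 1) : ℕ) : ℝ) = (((n + 1).choose l * (n + 1 - l) : ℕ) : ℝ) := by
      exact_mod_cast h2
    push_cast at h3
    linarith
  unfold TT
  rw [Finset.mul_sum]
  have : ∑ l ∈ Finset.Icc 2 n, ((n : ℝ) + 1) * ((n.choose l : ℝ) * (2 : ℝ) ^ l *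
        (((bernoulli l : ℚ) : ℝ) / (l : ℝ)) * eulerPoly (n - l) x) =
      ∑ l ∈ Finset.Icc 2 (n + 1), ((n : ℝ) + 1) * ((n.choose l : ℝ) * (2 : ℝ) ^ l *
        (((bernoulli l : ℚ) : ℝ) / (l : ℝ)) * eulerPoly (n - l) x) := by
    refine Finset.sum_subset (Finset.Icc_subset_Icc_right (by omega)) fun l hl hl' => ?_
    simp only [Finset.mem_Icc] at hl hl'
    rw [Nat.choose_eq_zero_of_lt (by omega)]
    simp
  rw [this]
  refine Finset.sum_congr rfl fun l hl => ?_
  have a : n + 1 - l - 1 = n - l := by omega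
  rw [a]
  linear_combination (2 : ℝ) ^ l * (((bernoulli l : ℚ) : ℝ) / (l : ℝ)) * eulerPoly (n - l) x * key l

noncomputable def PP (n : ℕ) (x : ℝ) : ℝ := SS n x - TT n x - harm n * eulerPoly n x

lemma PP_deriv (n : ℕ) (x : ℝ) : HasDerivAt (PP (n + 1)) ((n + 1) * PP n x) x := by
  refine (((SS_deriv n x).sub (TT_deriv n x)).sub
    ((ep_deriv n x).const_mul (harm (n + 1)))).congr_deriv ?_
  have : harm (n + 1) = harm n + 1 / (n + 1) := by simp [harm, Finset.sum_range_succ]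
  rw [this, PP]
  have : (n : ℝ) + 1 ≠ 0 := by positivity
  field_simp
  ring

lemma SS_end (n : ℕ) : SS (n + 2) 0 + SS (n + 2) 1 =
    2 * ((bernoulli (n + 2) : ℝ) / (n + 2)) - eulerPoly (n + 1) 0 := by
  have b1 : ((bernoulli 1 : ℚ) : ℝ) = -1 / 2 := by rw [bernoulli_one]; norm_num
  have aux : ∀ k ∈ Finset.Icc 2 (n + 1),
      bernoulliPoly k 0 / (k : ℝ) * eulerPoly (n + 2 - k) 0 +
      bernoulliPoly k 1 / (k : ℝ) * eulerPoly (n + 2 - k) 1 = 0 := by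
    intro k hk
    simp only [Finset.mem_Icc] at hk
    obtain ⟨j, hj⟩ : ∃ j, n + 2 - k = j + 1 := ⟨n + 2 - k - 1, by omega⟩
    rw [hj, ep_one, bp_zero, bp_one k (by omega)]; ring
  unfold SS
  rw [← Finset.sum_add_distrib, Finset.sum_Icc_succ_top (by omega),
    ← Finset.add_sum_Ioc_eq_sum_Icc (by omega : 1 ≤ n + 1)]
  have : Finset.Ioc 1 (n + 1) = Finset.Icc 2 (n + 1) := by ext; simp; omega
  rw [this, Finset.sum_eq_zero aux]
  have e : n + 2 - 1 = n + 1 := by omega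
  simp only [e, ep_one, bp1, Nat.sub_self, ep0, bp_zero, b1, bp_one (n + 1 + 1) (by omega)]
  push_cast
  have : (n : ℝ) + 1 + 1 = n + 2 := by ring
  rw [this]
  ring

lemma TT_end (n : ℕ) : TT (n + 2) 0 + TT (n + 2) 1 =
    2 * (2 ^ (n + 2) * ((bernoulli (n + 2) : ℝ) / (n + 2))) := by
  unfold TT
  rw [← Finset.sum_add_distrib, Finset.sum_Icc_succ_top (by omega), Finset.sum_eq_zero]
  · simp only [Nat.sub_self, ep0, Nat.choose_self]
    push_cast
    have : (n : ℝ) + 1 + 1 = n + 2 := by ring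
    rw [this]
    ring
  · intro k hk
    simp only [Finset.mem_Icc] at hk
    obtain ⟨j, hj⟩ : ∃ j, n + 2 - k = j + 1 := ⟨n + 2 - k - 1, by omega⟩
    rw [hj, ep_one]; ring

lemma PP_end (n : ℕ) : PP (n + 1) 0 + PP (n + 1) 1 = 0 := by
  cases n with
  | zero => 
    have := ep_one 0
    simp only [zero_add] at this
    simp [PP, SS, TT, bp1, ep0, harm, this]
    norm_num
  | succ n =>
    have h1 := SS_end n
    have h2 := TT_end n
    have h3 := ep_one (n + 1)
    have h4 := ep_zero (n + 1)
    push_cast at h4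
    have h5 : (n : ℝ) + 1 + 1 = n + 2 := by ring
    rw [h5] at h4
    simp only [PP, h3]
    rw [h4] at h1
    linear_combination h1 - h2

lemma PP_zero (n : ℕ) (x : ℝ) : PP n x = 0 := by
  induction n generalizing x with
  | zero => simp [PP, SS, TT, harm]
  | succ n ih =>
    have hc : ∀ x, PP (n + 1) x = PP (n + 1) 0 := fun x =>
      const_of (fun x => by simpa [ih] using PP_deriv n x) x 0
    have := PP_end n
    rw [hc 1] at this
    rw [hc x]; linarith

theorem stmt_13 (n : ℕ) (x : ℝ) :
    (∑ k ∈ Finset.Icc 1 n, bernoulliPoly k x / (k : ℝ) * eulerPoly (n - k) x) -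
      (∑ l ∈ Finset.Icc 2 n, (n.choose l : ℝ) * (2 : ℝ) ^ l *
        (((bernoulli l : ℚ) : ℝ) / (l : ℝ)) * eulerPoly (n - l) x) =
    harm n * eulerPoly n x := by
  have h := PP_zero n x
  unfold PP SS TT at h
  linarith
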